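/- arXiv:2112.15129 — 7 statements merged into one kernel-verified Lean document; each statement's English description precedes it below -/
import Mathlib

section
/- Let f be a cylindrical function on M₊(E) and suppose ν* ∈ M₊(E) satisfies f(ν*) = sup_{ν ∈ M₊(E)} f(ν). Then the second-order optimality condition holds: for every n ≥ 1, all points x₁,…,x_n ∈ supp(ν*) and all λ₁,…,λ_n ∈ ℝ one has Σ_{k,l=1}^n λ_k λ_l ∂²_{x_k x_l} f(ν*) ≤ 0. In particular ∂²_{xx} f(ν*) ≤ 0 for every x ∈ supp(ν*). -/
open MeasureTheory Topology

/-- The topological support of a measure: points all of whose open neighborhoods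
have positive measure. -/
def mSupport {E : Type*} [TopologicalSpace E] [MeasurableSpace E]
    (ν : Measure E) : Set E :=
  {x : E | ∀ U : Set E, IsOpen U → x ∈ U → 0 < ν U}

/-- The second-order necessary condition for a local maximum along a line. -/
theorem fderiv_fderiv_nonpos_of_isLocalMax_line
    {V : Type*} [NormedAddCommGroup V] [NormedSpace ℝ V] {φ : V → ℝ} (hφ : ContDiff ℝ 2 φ)
    {a w : V} (h : IsLocalMax (fun t : ℝ => φ (a + t • w)) 0) :
    fderiv ℝ (fderiv ℝ φ) a w w ≤ 0 := by
  have hline : ∀ t : ℝ, HasDerivAt (fun t : ℝ => a + t • w) w t := fun t => by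
    simpa using ((hasDerivAt_id t).smul_const w).const_add a
  have hφ' : ContDiff ℝ 1 (fderiv ℝ φ) := hφ.fderiv_right (by norm_num)
  have h1 : ∀ t : ℝ, HasDerivAt (fun t : ℝ => φ (a + t • w)) (fderiv ℝ φ (a + t • w) w) t :=
    fun t => ((hφ.differentiable (by norm_num)) _).hasFDerivAt.comp_hasDerivAt t (hline t)
  have hd : deriv (fun t : ℝ => φ (a + t • w)) = fun t => fderiv ℝ φ (a + t • w) w :=
    funext fun t => (h1 t).deriv
  have h2 : HasDerivAt (fun t : ℝ => fderiv ℝ φ (a + t • w) w)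
      (fderiv ℝ (fderiv ℝ φ) a w w) 0 := by
    have := ((hφ'.differentiable (by norm_num)) (a + (0 : ℝ) • w)).hasFDerivAt.comp_hasDerivAt 0
      (hline 0)
    simpa using this.clm_apply (hasDerivAt_const (0 : ℝ) w)
  by_contra! hpos
  have hmin : IsLocalMin (fun t : ℝ => φ (a + t • w)) 0 := by
    apply isLocalMin_of_deriv_deriv_pos _ h.deriv_eq_zero (h1 0).continuousAt
    rw [hd, h2.deriv]
    exact hpos
  have heq : (fun t : ℝ => φ (a + t • w)) =ᶠ[𝓝 0] fun _ => φ (a + (0 : ℝ) • w) := by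
    filter_upwards [h, hmin] with t ht ht' using le_antisymm ht ht'
  have h3 := heq.deriv.deriv_eq
  rw [hd, h2.deriv] at h3
  simp at h3
  linarith

/-- Perturbing a finite measure by a small multiple of a bounded density yields a finite measure,
and integrals of continuous functions change accordingly. -/
theorem exists_finiteMeasure_integral_eq_add
    {E : Type*} [TopologicalSpace E] [CompactSpace E] [MeasurableSpace E] [BorelSpace E]
    (ν : FiniteMeasure E) {h : E → ℝ} (hm : Measurable h) {C : ℝ} (hC : ∀ x, |h x| ≤ C)
    {t : ℝ} (ht : |t| * C ≤ 1) :
    ∃ μ : FiniteMeasure E, ∀ g : C(E, ℝ), ∫ x, g x ∂(μ : Measure E) =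
      ∫ x, g x ∂(ν : Measure E) + t * ∫ x, h x * g x ∂(ν : Measure E) := by
  have hnn : ∀ x, 0 ≤ 1 + t * h x := fun x => by
    have h1 : |t * h x| ≤ 1 := by
      rw [abs_mul]
      exact (mul_le_mul_of_nonneg_left (hC x) (abs_nonneg t)).trans ht
    linarith [(abs_le.mp h1).1]
  have hint : Integrable h (ν : Measure E) :=
    Integrable.of_bound hm.aestronglyMeasurable C (ae_of_all _ hC)
  have hint' : Integrable (fun x => 1 + t * h x) (ν : Measure E) :=
    (integrable_const 1).add (hint.const_mul t)
  have := isFiniteMeasure_withDensity_ofReal hint'.2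
  refine ⟨⟨(ν : Measure E).withDensity fun x => ENNReal.ofReal (1 + t * h x), this⟩, fun g => ?_⟩
  have hg : Integrable g (ν : Measure E) :=
    g.continuous.integrable_of_hasCompactSupport (HasCompactSupport.of_compactSpace g)
  have hhg : Integrable (fun x => h x * g x) (ν : Measure E) :=
    hg.bdd_mul hm.aestronglyMeasurable (ae_of_all _ hC)
  rw [FiniteMeasure.toMeasure_mk,
    integral_withDensity_eq_integral_toReal_smul (by fun_prop) (by simp),
    ← integral_const_mul, ← integral_add hg (hhg.const_mul t)]
  refine integral_congr_ae (ae_of_all _ fun x => ?_)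
  simp only [ENNReal.toReal_ofReal (hnn x), smul_eq_mul]
  ring

/-- Averages of a continuous function over small balls around a point of the support converge to
the value at that point. -/
theorem tendsto_inv_measureReal_ball_mul_setIntegral
    {E : Type*} [MetricSpace E] [MeasurableSpace E] [BorelSpace E]
    (ν : Measure E) [IsFiniteMeasure ν] {x : E} (hx : x ∈ mSupport ν)
    {g : E → ℝ} (hg : Continuous g) :
    Filter.Tendsto (fun r : ℝ => (ν.real (Metric.ball x r))⁻¹ * ∫ y in Metric.ball x r, g y ∂ν)
      (𝓝[>] 0) (𝓝 (g x)) := by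
  have hball : Filter.Tendsto (fun r : ℝ => Metric.ball x r) (𝓝[>] 0) (𝓝 x).smallSets := by
    rw [(Metric.nhds_basis_ball (x := x)).smallSets.tendsto_right_iff]
    intro ε hε
    filter_upwards [Ioo_mem_nhdsGT hε] with r hr using Metric.ball_subset_ball hr.2.le
  have ho := (hg.continuousAt (x := x)).integral_sub_linear_isLittleO_ae
    (hg.stronglyMeasurableAtFilter ν (𝓝 x)) hball
  have h1 := ho.tendsto_div_nhds_zero.add_const (g x)
  rw [zero_add] at h1
  refine h1.congr' ?_
  filter_upwards [self_mem_nhdsWithin] with r hr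
  have hpos : 0 < ν.real (Metric.ball x r) :=
    ENNReal.toReal_pos (hx _ Metric.isOpen_ball (Metric.mem_ball_self hr)).ne'
      (measure_ne_top _ _)
  rw [smul_eq_mul]
  field_simp
  ring

/-- Second-order optimality conditions at a maximizer of a cylindrical function on `M₊(E)`. -/
theorem stmt_1
    {E : Type*} [MetricSpace E] [CompactSpace E] [MeasurableSpace E] [BorelSpace E]
    (m : ℕ) (φ : (Fin m → ℝ) → ℝ) (hφ : ContDiff ℝ (⊤ : ℕ∞) φ)
    (g : Fin m → C(E, ℝ))
    (f : FiniteMeasure E → ℝ)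
    (hf : ∀ ν : FiniteMeasure E, f ν = φ (fun i => ∫ x, g i x ∂(ν : Measure E)))
    (D2 : FiniteMeasure E → E → E → ℝ)
    (hD2 : ∀ (ν : FiniteMeasure E) (x y : E),
      D2 ν x y = ∑ i, ∑ j,
        fderiv ℝ (fun w => fderiv ℝ φ w (Pi.single i 1))
            (fun k => ∫ z, g k z ∂(ν : Measure E)) (Pi.single j 1) * g i x * g j y)
    (νstar : FiniteMeasure E)
    (hmax : ∀ ν : FiniteMeasure E, f ν ≤ f νstar) :
    (∀ (n : ℕ), 1 ≤ n → ∀ (x : Fin n → E) (lam : Fin n → ℝ),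
      (∀ k, x k ∈ mSupport (νstar : Measure E)) →
      ∑ k, ∑ l, lam k * lam l * D2 νstar (x k) (x l) ≤ 0) ∧
    (∀ x ∈ mSupport (νstar : Measure E), D2 νstar x x ≤ 0) := by
  have hφ2 : ContDiff ℝ 2 φ := contDiff_infty.mp hφ 2
  have hφ' : Differentiable ℝ (fderiv ℝ φ) :=
    (hφ2.fderiv_right (m := 1) (by norm_num)).differentiable (by norm_num)
  set a : Fin m → ℝ := fun i => ∫ x, g i x ∂(νstar : Measure E) with ha
  set B := fderiv ℝ (fderiv ℝ φ) a with hB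
  have hBij : ∀ u : Fin m → ℝ, ∀ v : Fin m → ℝ,
      fderiv ℝ (fun w => fderiv ℝ φ w u) a v = B v u := fun u v => by
    rw [((hφ' a).hasFDerivAt.clm_apply (hasFDerivAt_const u a)).fderiv]
    simp [hB]
  have key : ∀ (h : E → ℝ), Measurable h → (∃ C, ∀ x, |h x| ≤ C) →
      B (fun i => ∫ x, h x * g i x ∂(νstar : Measure E))
        (fun i => ∫ x, h x * g i x ∂(νstar : Measure E)) ≤ 0 := by
    rintro h hm ⟨C, hC⟩
    apply fderiv_fderiv_nonpos_of_isLocalMax_line hφ2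
    have hev : ∀ᶠ t : ℝ in 𝓝 0, |t| * C < 1 := by
      have : Filter.Tendsto (fun t : ℝ => |t| * C) (𝓝 0) (𝓝 (|0| * C)) :=
        (continuous_abs.mul continuous_const).tendsto 0
      exact this.eventually_lt_const (by simp)
    filter_upwards [hev] with t ht
    obtain ⟨μ, hμ⟩ := exists_finiteMeasure_integral_eq_add νstar hm hC ht.le
    have h1 := hmax μ
    rw [hf, hf] at h1
    simp only [hμ] at h1
    simpa [ha, Pi.add_def, Pi.smul_def] using h1
  have main : ∀ (n : ℕ) (x : Fin n → E) (lam : Fin n → ℝ),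
      (∀ k, x k ∈ mSupport (νstar : Measure E)) →
      ∑ k, ∑ l, lam k * lam l * D2 νstar (x k) (x l) ≤ 0 := by
    intro n x lam hx
    let c : ℝ → Fin n → ℝ := fun r k => ((νstar : Measure E).real (Metric.ball (x k) r))⁻¹
    let h : ℝ → E → ℝ := fun r y =>
      ∑ k, (Metric.ball (x k) r).indicator (fun _ => lam k * c r k) y
    let v : Fin m → ℝ := fun i => ∑ k, lam k * g i (x k)
    have hmeas : ∀ r, Measurable (h r) := fun r =>
      Finset.measurable_sum _ fun k _ => measurable_const.indicator Metric.isOpen_ball.measurableSet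
    have hbdd : ∀ r, ∃ C, ∀ y, |h r y| ≤ C := fun r =>
      ⟨∑ k, |lam k * c r k|, fun y => (Finset.abs_sum_le_sum_abs _ _).trans
        (Finset.sum_le_sum fun k _ => by
          simpa only [Real.norm_eq_abs] using norm_indicator_le_norm_self (fun _ : E => lam k * c r k) y)⟩
    have hint : ∀ r i, ∫ y, h r y * g i y ∂(νstar : Measure E) =
        ∑ k, lam k * (c r k * ∫ y in Metric.ball (x k) r, g i y ∂(νstar : Measure E)) := by
      intro r i
      have hg : Integrable (g i) (νstar : Measure E) :=
        (g i).continuous.integrable_of_hasCompactSupport (HasCompactSupport.of_compactSpace _)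
      have hpt : ∀ y, h r y * g i y =
          ∑ k, (Metric.ball (x k) r).indicator (fun y => lam k * c r k * g i y) y := fun y => by
        simp only [h, Finset.sum_mul]
        refine Finset.sum_congr rfl fun k _ => ?_
        by_cases hy : y ∈ Metric.ball (x k) r <;> simp [Set.indicator, hy]
      simp only [hpt]
      rw [integral_finsetSum _ fun k _ =>
        (hg.const_mul _).indicator Metric.isOpen_ball.measurableSet]
      refine Finset.sum_congr rfl fun k _ => ?_
      rw [integral_indicator Metric.isOpen_ball.measurableSet, integral_const_mul, mul_assoc]
    have hlim : Filter.Tendsto (fun r i => ∫ y, h r y * g i y ∂(νstar : Measure E))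
        (𝓝[>] 0) (𝓝 v) := by
      rw [tendsto_pi_nhds]
      intro i
      simp only [hint]
      exact tendsto_finsetSum _ fun k _ =>
        (tendsto_inv_measureReal_ball_mul_setIntegral _ (hx k) (g i).continuous).const_mul _
    have hBv : B v v ≤ 0 := by
      have hcont : Continuous fun w => B w w := by fun_prop
      exact le_of_tendsto ((hcont.tendsto v).comp hlim)
        (Filter.Eventually.of_forall fun r => key (h r) (hmeas r) (hbdd r))
    have hdecomp : ∀ u : Fin m → ℝ, u = ∑ i, u i • (Pi.single i 1 : Fin m → ℝ) := fun u => by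
      simpa using (pi_eq_sum_univ' u)
    have hD : ∀ y z, D2 νstar y z = B (fun i => g i z) (fun i => g i y) := fun y z => by
      rw [hD2, hdecomp fun i => g i z, hdecomp fun i => g i y]
      simp only [map_sum, map_smul, sum_apply, smul_apply,
        smul_eq_mul, Finset.mul_sum, ← ha, hBij]
      exact Finset.sum_congr rfl fun i _ => Finset.sum_congr rfl fun j _ => by ring
    have hv : v = ∑ k, lam k • fun i => g i (x k) := by
      ext i
      simp [v]
    rw [hv] at hBv
    simp only [map_sum, map_smul, sum_apply, smul_apply,
      smul_eq_mul, Finset.mul_sum] at hBv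
    refine le_of_eq_of_le ?_ hBv
    exact Finset.sum_congr rfl fun k _ => Finset.sum_congr rfl fun l _ => by rw [hD]; ring
  exact ⟨fun n _ => main n, fun x hx => by simpa using main 1 (fun _ => x) (fun _ => 1) fun _ => hx⟩
end

section
/- Let E be a compact metric space and let A : C(E) → C(E) be a bounded linear operator such that for every t ∈ ℝ the operator exponential exp(tA) is positive, i.e., exp(tA)g ≥ 0 pointwise whenever g ∈ C(E) satisfies g ≥ 0. Then A is a multiplication operator: there exists a ∈ C(E) (namely a = A1, where 1 is the constant function one) such that Ag(x) = a(x)·g(x) for all g ∈ C(E) and x ∈ E. -/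
open MeasureTheory Topology

/-- The exponential `exp A = ∑ Aⁿ/n!` of a bounded linear operator `A` on `C(E)`,
defined by the (norm-convergent) power series. -/
noncomputable def expOp {E : Type*} [MetricSpace E] [CompactSpace E]
    (A : C(E, ℝ) →L[ℝ] C(E, ℝ)) : C(E, ℝ) →L[ℝ] C(E, ℝ) :=
  ∑' n : ℕ, (n.factorial : ℝ)⁻¹ • A ^ n

theorem hasDerivAt_tsum_smul_pow_apply_zero {X : Type*} [NormedAddCommGroup X] [NormedSpace ℝ X]
    [CompleteSpace X] (A : X →L[ℝ] X) (v : X) (φ : X →L[ℝ] ℝ) :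
    HasDerivAt (fun t : ℝ => φ ((∑' n : ℕ, (n.factorial : ℝ)⁻¹ • (t • A) ^ n) v)) (φ (A v)) 0 := by
  have h := hasDerivAt_exp_smul_const (𝕂 := ℝ) A 0
  simp only [NormedSpace.exp_eq_tsum ℝ, zero_smul, NormedSpace.exp_zero, one_mul] at h
  exact (φ.comp (ContinuousLinearMap.apply ℝ X v)).hasFDerivAt.comp_hasDerivAt (0 : ℝ) h

theorem hasDerivAt_expOp_smul_apply {E : Type*} [MetricSpace E] [CompactSpace E]
    (A : C(E, ℝ) →L[ℝ] C(E, ℝ)) (g : C(E, ℝ)) (x : E) :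
    HasDerivAt (fun t : ℝ => expOp (t • A) g x) (A g x) 0 :=
  hasDerivAt_tsum_smul_pow_apply_zero A g (ContinuousMap.evalCLM ℝ x)

theorem expOp_zero {E : Type*} [MetricSpace E] [CompactSpace E] :
    expOp (0 : C(E, ℝ) →L[ℝ] C(E, ℝ)) = 1 := by
  rw [expOp, tsum_eq_single 0 fun n hn => by rw [zero_pow hn, smul_zero]]
  simp

theorem apply_eq_zero_of_nonneg_of_expOp_nonneg {E : Type*} [MetricSpace E] [CompactSpace E]
    (A : C(E, ℝ) →L[ℝ] C(E, ℝ))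
    (hpos : ∀ t : ℝ, ∀ g : C(E, ℝ), (∀ x, 0 ≤ g x) →
      ∀ x, 0 ≤ (expOp (t • A)) g x)
    {g : C(E, ℝ)} (hg : ∀ y, 0 ≤ g y) {x : E} (hx : g x = 0) : A g x = 0 := by
  have hmin : IsLocalMin (fun t : ℝ => expOp (t • A) g x) 0 := by
    refine Filter.Eventually.of_forall fun t => ?_
    simpa [expOp_zero, hx] using hpos t g hg x
  exact hmin.hasDerivAt_eq_zero (hasDerivAt_expOp_smul_apply A g x)

/-- If `A` is a bounded linear operator on `C(E)` (`E` compact metric) such that `exp (tA)` is a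
positive operator for every `t ∈ ℝ`, then `A` is the multiplication operator by `a = A1`. -/
theorem stmt_2 {E : Type*} [MetricSpace E] [CompactSpace E]
    (A : C(E, ℝ) →L[ℝ] C(E, ℝ))
    (hpos : ∀ t : ℝ, ∀ g : C(E, ℝ), (∀ x, 0 ≤ g x) →
      ∀ x, 0 ≤ (expOp (t • A)) g x) :
    ∀ (g : C(E, ℝ)) (x : E), A g x = (A 1) x * g x := by
  intro g x
  set f : C(E, ℝ) := g - g x • 1 with hf
  have hfx : f x = 0 := by simp [hf]
  have hp : A (f ⊔ 0) x = 0 :=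
    apply_eq_zero_of_nonneg_of_expOp_nonneg A hpos (by simp) (by simp [hfx])
  have hn : A (-f ⊔ 0) x = 0 :=
    apply_eq_zero_of_nonneg_of_expOp_nonneg A hpos (by simp) (by simp [hfx])
  have hdecomp : f = (f ⊔ 0) - (-f ⊔ 0) := (posPart_sub_negPart f).symm
  have hAf : A f x = 0 := by
    rw [hdecomp, map_sub, ContinuousMap.sub_apply, hp, hn, sub_zero]
  simp only [hf, map_sub, map_smul, ContinuousMap.sub_apply, ContinuousMap.smul_apply,
    smul_eq_mul] at hAf
  linarith
end

section
/- Let E be a compact metric space, let D be a dense linear subspace of C(E) containing the constant function 1, and let Q₁ : D × D → C(E) be a symmetric bilinear map. Then the following two conditions are equivalent: (1) ∫_E Q₁(g,g) dν ≥ 0 for all g ∈ D and all ν ∈ M₊(E), with equality whenever g ≡ 0 on supp(ν); (2) Q₁(g,g)(x) ≥ 0 for all g ∈ D and x ∈ E, with equality whenever g(x) = 0. Moreover, either condition implies that there exists a function α ∈ C(E) with α ≥ 0 such that Q₁(g,h)(x) = α(x)·g(x)·h(x) for all g, h ∈ D and all x ∈ E. -/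
open MeasureTheory Topology

theorem mSupport_eq_support {E : Type*} [TopologicalSpace E] [MeasurableSpace E]
    (ν : Measure E) : mSupport ν = ν.support := by
  ext x
  rw [(nhds_basis_opens x).mem_measureSupport]
  exact ⟨fun h U hU => h U hU.2 hU.1, fun h U hU hx => h U ⟨hx, hU⟩⟩

/-- A positive symmetric bilinear form vanishes against every null vector. -/
theorem bilin_eq_zero_of_self_eq_zero {V : Type*} [AddCommGroup V] [Module ℝ V]
    (B : V →ₗ[ℝ] V →ₗ[ℝ] ℝ) (hsymm : ∀ u v, B u v = B v u) (hB : ∀ u, 0 ≤ B u u)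
    {u : V} (hu : B u u = 0) (v : V) : B u v = 0 := by
  have key : ∀ t : ℝ, 0 ≤ B v v + 2 * t * B u v := fun t => by
    have h := hB (v + t • u)
    simp only [map_add, map_smul, LinearMap.add_apply, LinearMap.smul_apply, smul_eq_mul,
      hu, hsymm v u] at h
    linarith
  by_contra hne
  have h := key (-(B v v + 1) / (2 * B u v))
  field_simp at h
  linarith

/-- A positive symmetric bilinear form that vanishes on the kernel of a linear functional `φ`
is a multiple of `φ ⊗ φ`. -/
theorem bilin_eq_mul_of_ker {V : Type*} [AddCommGroup V] [Module ℝ V]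
    (B : V →ₗ[ℝ] V →ₗ[ℝ] ℝ) (hsymm : ∀ u v, B u v = B v u) (hB : ∀ u, 0 ≤ B u u)
    (φ : V →ₗ[ℝ] ℝ) (hφ : ∀ u, φ u = 0 → B u u = 0) {e : V} (he : φ e = 1) (u v : V) :
    B u v = B e e * φ u * φ v := by
  have hker : ∀ u v, B u v = φ u * B e v := fun u v => by
    have h := bilin_eq_zero_of_self_eq_zero B hsymm hB (hφ (u - φ u • e) (by simp [he])) v
    simp only [map_sub, map_smul, LinearMap.sub_apply, LinearMap.smul_apply, smul_eq_mul] at h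
    linarith
  rw [hker u v, hsymm e v, hker v e]
  ring

/-- Characterization of the diffusion operator `Q₁`: the integral positivity/vanishing
condition is equivalent to the pointwise one, and either implies that `Q₁` is a diagonal
multiplication operator `Q₁(g,h)(x) = α(x)·g(x)·h(x)` with `0 ≤ α ∈ C(E)`. -/
theorem stmt_4 {E : Type*} [MetricSpace E] [CompactSpace E] [MeasurableSpace E] [BorelSpace E]
    (D : Submodule ℝ C(E, ℝ)) (hD : Dense (D : Set C(E, ℝ))) (h1 : (1 : C(E, ℝ)) ∈ D)
    (Q₁ : D →ₗ[ℝ] D →ₗ[ℝ] C(E, ℝ))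
    (hsymm : ∀ g h : D, Q₁ g h = Q₁ h g) :
    ((∀ (g : D) (ν : FiniteMeasure E),
        0 ≤ ∫ x, Q₁ g g x ∂(ν : Measure E) ∧
        ((∀ x ∈ mSupport (ν : Measure E), (g : C(E, ℝ)) x = 0) →
          ∫ x, Q₁ g g x ∂(ν : Measure E) = 0)) ↔
      (∀ (g : D) (x : E),
        0 ≤ Q₁ g g x ∧ ((g : C(E, ℝ)) x = 0 → Q₁ g g x = 0))) ∧
    ((∀ (g : D) (x : E), 0 ≤ Q₁ g g x ∧ ((g : C(E, ℝ)) x = 0 → Q₁ g g x = 0)) →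
      ∃ α : C(E, ℝ), (∀ x, 0 ≤ α x) ∧
        ∀ (g h : D) (x : E), Q₁ g h x = α x * (g : C(E, ℝ)) x * (h : C(E, ℝ)) x) := by
  refine ⟨⟨fun h g x => ?_, fun h g ν => ⟨integral_nonneg fun x => (h g x).1, fun hg => ?_⟩⟩,
    fun h => ⟨Q₁ ⟨1, h1⟩ ⟨1, h1⟩, fun x => (h _ x).1, fun g h' x => ?_⟩⟩
  · obtain ⟨hpos, hzero⟩ := h g ⟨Measure.dirac x, inferInstance⟩
    simp only [FiniteMeasure.toMeasure_mk, integral_dirac] at hpos hzero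
    refine ⟨hpos, fun hx => hzero fun y hy => ?_⟩
    suffices y = x by rw [this, hx]
    by_contra hne
    have hpos' := hy {x}ᶜ isOpen_compl_singleton hne
    simp at hpos'
  · rw [mSupport_eq_support] at hg
    refine integral_eq_zero_of_ae ?_
    filter_upwards [Measure.support_mem_ae (μ := (ν : Measure E))] with x hx
    exact (h g x).2 (hg x hx)
  · let ev : C(E, ℝ) →ₗ[ℝ] ℝ := (ContinuousMap.evalCLM ℝ x).toLinearMap
    exact bilin_eq_mul_of_ker (Q₁.compr₂ ev) (fun u v => congrArg ev (hsymm u v))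
      (fun u => (h u x).1) (ev ∘ₗ D.subtype) (fun u hu => (h u x).2 hu)
      (e := ⟨1, h1⟩) rfl g h'
end

section
/- Let E be a compact metric space and let Q₂ : C(E) × C(E) → C(E×E) be a symmetric bilinear map whose values are symmetric functions, i.e., Q₂(g,h)(x,y) = Q₂(g,h)(y,x). Then the following two conditions are equivalent: (i) ∫_{E×E} Q₂(g,g) d(ν⊗ν) ≥ 0 for all g ∈ C(E) and all ν ∈ M₊(E), with equality whenever g ≡ 0 on supp(ν); (ii) for every g ∈ C(E) the map (x,y) ↦ Q₂(g,g)(x,y) is a copositive kernel on E, i.e., Σ_{i,j=1}^n c_i c_j Q₂(g,g)(x_i,x_j) ≥ 0 for all n ≥ 1, x₁,…,x_n ∈ E and c₁,…,c_n ≥ 0, and moreover Q₂(g,g)(x,y) = 0 whenever g(x) = g(y) = 0. -/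
open MeasureTheory Topology

section CopositiveKernel

variable {E : Type*} [MetricSpace E] [CompactSpace E] [MeasurableSpace E] [BorelSpace E]

theorem integrable_of_compactSpace {X : Type*} [TopologicalSpace X] [CompactSpace X]
    [MeasurableSpace X] [OpensMeasurableSpace X] (μ : Measure X) [IsFiniteMeasure μ]
    {f : X → ℝ} (hf : Continuous f) : Integrable f μ :=
  hf.integrable_of_hasCompactSupport (HasCompactSupport.of_compactSpace f)

theorem measure_compl_mSupport {X : Type*} [TopologicalSpace X] [SecondCountableTopology X]
    [MeasurableSpace X] (μ : Measure X) :
    μ (mSupport μ)ᶜ = 0 := by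
  refine measure_null_of_locally_null _ fun x hx => ?_
  simp only [mSupport, Set.mem_compl_iff, Set.mem_ofPred_eq, not_forall, not_lt,
    nonpos_iff_eq_zero] at hx
  obtain ⟨U, hU, hxU, h0⟩ := hx
  exact ⟨U, mem_nhdsWithin_of_mem_nhds (hU.mem_nhds hxU), h0⟩

/-- The discrete measure with masses `c i` at the points `x i`. -/
noncomputable def discreteMeasure {X ι : Type*} [MeasurableSpace X] [Fintype ι] (x : ι → X)
    (c : ι → NNReal) : FiniteMeasure X :=
  ⟨∑ i, c i • Measure.dirac (x i), inferInstance⟩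

theorem integral_discreteMeasure {ι : Type*} [Fintype ι] (x : ι → E) (c : ι → NNReal)
    {f : E → ℝ} (hf : Continuous f) :
    ∫ y, f y ∂(discreteMeasure x c : Measure E) = ∑ i, (c i : ℝ) * f (x i) := by
  change ∫ y, f y ∂(∑ i, c i • Measure.dirac (x i)) = _
  rw [integral_finsetSum_measure fun i _ => integrable_of_compactSpace _ hf]
  simp [integral_smul_nnreal_measure, NNReal.smul_def]

theorem integral_discreteMeasure_prod {ι : Type*} [Fintype ι] (x : ι → E) (c : ι → NNReal)
    {f : E × E → ℝ} (hf : Continuous f) :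
    ∫ p, f p ∂((discreteMeasure x c : Measure E).prod (discreteMeasure x c : Measure E)) =
      ∑ i, ∑ j, (c i : ℝ) * c j * f (x i, x j) := by
  rw [integral_prod _ (integrable_of_compactSpace _ hf)]
  have h : ∀ a, ∫ b, f (a, b) ∂(discreteMeasure x c : Measure E) =
      ∑ j, (c j : ℝ) * f (a, x j) := fun a => integral_discreteMeasure x c (by fun_prop)
  simp_rw [h]
  rw [integral_discreteMeasure x c (by fun_prop)]
  simp_rw [Finset.mul_sum, mul_assoc]

theorem mSupport_discreteMeasure_subset {X ι : Type*} [TopologicalSpace X] [T1Space X]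
    [MeasurableSpace X] [OpensMeasurableSpace X] [Fintype ι] (x : ι → X) (c : ι → NNReal) :
    mSupport (discreteMeasure x c : Measure X) ⊆ Set.range x := by
  intro y hy
  by_contra hyx
  have hopen : IsOpen (Set.range x)ᶜ := (Set.finite_range x).isClosed.isOpen_compl
  refine (hy _ hopen hyx).ne' ?_
  change (∑ i, c i • Measure.dirac (x i) : Measure X) _ = 0
  simp [Measure.dirac_apply' _ hopen.measurableSet]

/-- Copositive kernels: all quadratic forms with nonnegative coefficients are nonnegative. -/
def IsCopositiveKernel {X : Type*} (f : X × X → ℝ) : Prop :=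
  ∀ (n : ℕ) (x : Fin n → X) (c : Fin n → ℝ), (∀ i, 0 ≤ c i) →
    0 ≤ ∑ i, ∑ j, c i * c j * f (x i, x j)

theorem IsCopositiveKernel.sum_nonneg {X : Type*} {f : X × X → ℝ} (hf : IsCopositiveKernel f)
    (s : Finset X) {c : X → ℝ} (hc : ∀ a, 0 ≤ c a) :
    0 ≤ ∑ a ∈ s, ∑ b ∈ s, c a * c b * f (a, b) := by
  have h := hf s.card (fun i => (s.equivFin.symm i : X)) (fun i => c (s.equivFin.symm i))
    fun i => hc _
  rw [s.equivFin.symm.sum_comp fun a : s =>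
    ∑ j, c a * c (s.equivFin.symm j) * f (a, (s.equivFin.symm j : X))] at h
  simp_rw [fun a : s => s.equivFin.symm.sum_comp fun b : s => c a * c b * f (a, b)] at h
  rw [← Finset.sum_coe_sort s]
  simpa only [← Finset.sum_coe_sort s] using h

theorem IsCopositiveKernel.integral_simpleFunc_nonneg {X : Type*} [MeasurableSpace X]
    {f : X × X → ℝ} (hf : IsCopositiveKernel f) (μ : Measure X) [IsFiniteMeasure μ]
    (s : SimpleFunc X X) : 0 ≤ ∫ p, f (s p.1, s p.2) ∂(μ.prod μ) := by
  classical
  let e : X → X → ℝ := fun a => (s ⁻¹' {a}).indicator 1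
  have he : ∀ a, Integrable (e a) μ := fun a =>
    (integrable_const (1 : ℝ)).indicator (s.measurableSet_fiber a)
  have hexp : ∀ p : X × X, f (s p.1, s p.2) =
      ∑ a ∈ s.range, ∑ b ∈ s.range, e a p.1 * e b p.2 * f (a, b) := by
    intro p
    rw [Finset.sum_eq_single_of_mem (s p.1) (s.mem_range_self _),
      Finset.sum_eq_single_of_mem (s p.2) (s.mem_range_self _)]
    · simp [e]
    · intro b _ hb
      simp [e, hb.symm]
    · intro a _ ha
      simp [e, Set.indicator, ha.symm]
  have hint : ∀ a b, Integrable (fun p : X × X => e a p.1 * e b p.2 * f (a, b)) (μ.prod μ) :=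
    fun a b => ((he a).mul_prod (he b)).mul_const _
  simp_rw [hexp]
  rw [integral_finsetSum _ fun a _ => integrable_finsetSum _ fun b _ => hint a b]
  simp_rw [fun a => integral_finsetSum s.range fun b _ => hint a b, integral_mul_const,
    integral_prod_mul]
  exact hf.sum_nonneg _ fun a => integral_nonneg fun x =>
    Set.indicator_nonneg (fun _ _ => zero_le_one) x

theorem IsCopositiveKernel.integral_nonneg {f : C(E × E, ℝ)} (hf : IsCopositiveKernel f)
    (μ : Measure E) [IsFiniteMeasure μ] : 0 ≤ ∫ p, f p ∂(μ.prod μ) := by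
  rcases isEmpty_or_nonempty E with hE | ⟨⟨x₀⟩⟩
  · simp [Measure.eq_zero_of_isEmpty]
  let s : ℕ → SimpleFunc E E :=
    SimpleFunc.approxOn id measurable_id Set.univ x₀ (Set.mem_univ x₀)
  have hs : ∀ x, Filter.Tendsto (fun n => s n x) Filter.atTop (𝓝 x) := fun x =>
    SimpleFunc.tendsto_approxOn measurable_id (Set.mem_univ x₀) (by simp)
  refine ge_of_tendsto' (tendsto_integral_of_dominated_convergence (fun _ => ‖f‖)
    (F := fun n p => f (s n p.1, s n p.2)) (fun n => ?_) (integrable_const _)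
    (fun n => ae_of_all _ fun p => f.norm_coe_le_norm _) (ae_of_all _ fun p => ?_))
    fun n => hf.integral_simpleFunc_nonneg μ (s n)
  · exact (f.continuous.measurable.comp (((s n).measurable.comp measurable_fst).prodMk
      ((s n).measurable.comp measurable_snd))).aestronglyMeasurable
  · exact (f.continuous.tendsto p).comp ((hs p.1).prodMk_nhds (hs p.2))

theorem integral_prod_eq_zero_of_forall_mSupport {X : Type*} [TopologicalSpace X]
    [SecondCountableTopology X] [MeasurableSpace X] {f : X × X → ℝ} (μ : Measure X)
    [IsFiniteMeasure μ] (hf : ∀ x ∈ mSupport μ, ∀ y ∈ mSupport μ, f (x, y) = 0) :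
    ∫ p, f p ∂(μ.prod μ) = 0 := by
  have hmem : ∀ᵐ x ∂μ, x ∈ mSupport μ := measure_compl_mSupport μ
  refine integral_eq_zero_of_ae ?_
  filter_upwards [Measure.quasiMeasurePreserving_fst.ae hmem,
    Measure.quasiMeasurePreserving_snd.ae hmem] with p h₁ h₂
  exact hf p.1 h₁ p.2 h₂

end CopositiveKernel

/-- Equivalence of the integral positivity/vanishing conditions for `Q₂` against `ν ⊗ ν` with
the copositivity of the kernels `(x,y) ↦ Q₂(g,g)(x,y)` plus the vanishing condition. -/
theorem stmt_5 {E : Type*} [MetricSpace E] [CompactSpace E] [MeasurableSpace E] [BorelSpace E]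
    (Q₂ : C(E, ℝ) →ₗ[ℝ] C(E, ℝ) →ₗ[ℝ] C(E × E, ℝ))
    (hsymm : ∀ g h : C(E, ℝ), Q₂ g h = Q₂ h g)
    (hsymval : ∀ (g h : C(E, ℝ)) (x y : E), Q₂ g h (x, y) = Q₂ g h (y, x)) :
    (∀ (g : C(E, ℝ)) (ν : FiniteMeasure E),
        0 ≤ ∫ p, Q₂ g g p ∂((ν : Measure E).prod (ν : Measure E)) ∧
        ((∀ x ∈ mSupport (ν : Measure E), g x = 0) →
          ∫ p, Q₂ g g p ∂((ν : Measure E).prod (ν : Measure E)) = 0)) ↔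
    (∀ g : C(E, ℝ),
        (∀ (n : ℕ) (x : Fin n → E) (c : Fin n → ℝ), (∀ i, 0 ≤ c i) →
          0 ≤ ∑ i, ∑ j, c i * c j * Q₂ g g (x i, x j)) ∧
        (∀ x y : E, g x = 0 → g y = 0 → Q₂ g g (x, y) = 0)) := by
  constructor
  · refine fun h g => ⟨fun n x c hc => ?_, fun x y hx hy => ?_⟩
    · have h₀ := (h g (discreteMeasure x fun i => (c i).toNNReal)).1
      rw [integral_discreteMeasure_prod x _ (Q₂ g g).continuous] at h₀
      simpa only [Real.coe_toNNReal _ (hc _)] using h₀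
    · have hzero : ∀ {n : ℕ} (z : Fin n → E), (∀ i, g (z i) = 0) →
          ∑ i, ∑ j, Q₂ g g (z i, z j) = 0 := by
        intro n z hz
        have h₀ := (h g (discreteMeasure z 1)).2 fun w hw => by
          obtain ⟨i, rfl⟩ := mSupport_discreteMeasure_subset z 1 hw
          exact hz i
        rw [integral_discreteMeasure_prod _ _ (Q₂ g g).continuous] at h₀
        simpa using h₀
      have hxx := hzero ![x] (by simp [hx])
      have hyy := hzero ![y] (by simp [hy])
      have hxy := hzero ![x, y] (by simp [Fin.forall_fin_two, hx, hy])
      simp only [Fin.sum_univ_two, Fin.sum_univ_one, Matrix.cons_val_zero,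
        Matrix.cons_val_one] at hxx hyy hxy
      linarith [hsymval g g x y]
  · exact fun h g ν => ⟨IsCopositiveKernel.integral_nonneg (h g).1 _, fun hg =>
      integral_prod_eq_zero_of_forall_mSupport _ fun x hx y hy =>
        (h g).2 x y (hg x hx) (hg y hy)⟩
end

section
/- Let E be a compact metric space and let Q₂ : C(E) × C(E) → C(E×E) be a symmetric bilinear map whose values are symmetric functions, such that for every g ∈ C(E) the kernel (x,y) ↦ Q₂(g,g)(x,y) is copositive (Σ_{i,j} c_i c_j Q₂(g,g)(x_i,x_j) ≥ 0 for all finitely many points x_i ∈ E and coefficients c_i ≥ 0) and Q₂(g,g)(x,y) = 0 whenever g(x) = g(y) = 0. Then Q₂ admits a (β,π)-representation: there exist a function π : E×E → ℝ₊ with π(x,x) = 0 for all x ∈ E and a symmetric function β : E×E → ℝ with β(x,x) ≥ 0 for all x ∈ E, both bounded and continuous on E×E minus the diagonal, with π + π̄ + 2β ∈ C(E×E) where π̄(x,y) := π(y,x), such that Q₂(g,g)(x,y) = ½(π(x,y)g(x)² + π(y,x)g(y)² + 2β(x,y)g(x)g(y)) for all g ∈ C(E) and x,y ∈ E, and such that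 for every n ≥ 1, all points x₁,…,x_n ∈ E and all c₁,…,c_n > 0 the n×n matrix with entries β(x_i,x_j) plus the diagonal matrix with entries Σ_{j=1}^n (c_j/c_i)π(x_i,x_j) is positive semidefinite. -/
open MeasureTheory Topology

section Representation

variable {E : Type*} [MetricSpace E]

/-- `IsBetaPiRep Q π β`: the polarized `(β,π)`-representation of the bilinear map `Q`. -/
def IsBetaPiRep (Q : C(E, ℝ) →ₗ[ℝ] C(E, ℝ) →ₗ[ℝ] C(E × E, ℝ)) (π β : E × E → ℝ) : Prop :=
  ∀ (g h : C(E, ℝ)) (x y : E), 2 * Q g h (x, y) =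
    π (x, y) * (g x * h x) + π (y, x) * (g y * h y) + β (x, y) * (g x * h y + g y * h x)

/-- If a symmetric bilinear form is bounded below on a line with isotropic direction `g`, through `h`,
then it vanishes at `(g, h)`. -/
theorem LinearMap.eq_zero_of_isotropic_of_boundedBelow {V : Type*} [AddCommGroup V] [Module ℝ V]
    (B : V →ₗ[ℝ] V →ₗ[ℝ] ℝ) (hsymm : ∀ g h, B g h = B h g) {g h : V} {K : ℝ}
    (hK : ∀ t : ℝ, 0 ≤ K + B (h + t • g) (h + t • g)) (hg : B g g = 0) : B g h = 0 := by
  have key : ∀ t : ℝ, 0 ≤ K + B h h + 2 * t * B g h := fun t => by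
    have h1 := hK t
    simp only [map_add, map_smul, LinearMap.add_apply, LinearMap.smul_apply, smul_eq_mul, hg,
      hsymm h g] at h1
    linarith
  by_contra hne
  have h1 := key (-(K + B h h + 1) / (2 * B g h))
  have h2 : 2 * (-(K + B h h + 1) / (2 * B g h)) * B g h = -(K + B h h + 1) := by
    field_simp
  linarith

variable {Q : C(E, ℝ) →ₗ[ℝ] C(E, ℝ) →ₗ[ℝ] C(E × E, ℝ)}

/-- The bilinear form obtained by evaluating `Q` at a point. -/
def evalForm (Q : C(E, ℝ) →ₗ[ℝ] C(E, ℝ) →ₗ[ℝ] C(E × E, ℝ)) (p : E × E) :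
    C(E, ℝ) →ₗ[ℝ] C(E, ℝ) →ₗ[ℝ] ℝ :=
  LinearMap.mk₂ ℝ (fun g h => Q g h p) (by simp) (by simp) (by simp) (by simp)

@[simp]
theorem evalForm_apply (p : E × E) (g h : C(E, ℝ)) : evalForm Q p g h = Q g h p := rfl

theorem eval_nonneg_of_copositive
    (hcopos : ∀ (g : C(E, ℝ)) (n : ℕ) (x : Fin n → E) (c : Fin n → ℝ), (∀ i, 0 ≤ c i) →
      0 ≤ ∑ i, ∑ j, c i * c j * Q g g (x i, x j)) (g : C(E, ℝ)) (x : E) :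
    0 ≤ Q g g (x, x) := by
  simpa using hcopos g 1 (fun _ => x) (fun _ => 1) (by simp)

theorem eval_two_nonneg_of_copositive
    (hsymval : ∀ (g h : C(E, ℝ)) (x y : E), Q g h (x, y) = Q g h (y, x))
    (hcopos : ∀ (g : C(E, ℝ)) (n : ℕ) (x : Fin n → E) (c : Fin n → ℝ), (∀ i, 0 ≤ c i) →
      0 ≤ ∑ i, ∑ j, c i * c j * Q g g (x i, x j)) (g : C(E, ℝ)) (x y : E) {c : ℝ} (hc : 0 ≤ c) :
    0 ≤ Q g g (x, x) + 2 * c * Q g g (x, y) + c ^ 2 * Q g g (y, y) := by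
  have h1 := hcopos g 2 ![x, y] ![1, c] (by intro i; fin_cases i <;> simp [hc])
  simp [Fin.sum_univ_two, hsymval g g y x] at h1
  linarith

theorem eval_diag_eq_zero
    (hsymm : ∀ g h : C(E, ℝ), Q g h = Q h g)
    (hcopos : ∀ (g : C(E, ℝ)) (n : ℕ) (x : Fin n → E) (c : Fin n → ℝ), (∀ i, 0 ≤ c i) →
      0 ≤ ∑ i, ∑ j, c i * c j * Q g g (x i, x j))
    (hvanish : ∀ (g : C(E, ℝ)) (x y : E), g x = 0 → g y = 0 → Q g g (x, y) = 0)
    (g h : C(E, ℝ)) {x : E} (hx : g x = 0) : Q g h (x, x) = 0 :=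
  LinearMap.eq_zero_of_isotropic_of_boundedBelow (evalForm Q (x, x)) (K := 0)
    (fun g h => by simp [hsymm g h])
    (fun t => by
      rw [zero_add]
      exact eval_nonneg_of_copositive hcopos _ x)
    (hvanish g x x hx hx)

theorem eval_diag
    (hsymm : ∀ g h : C(E, ℝ), Q g h = Q h g)
    (hcopos : ∀ (g : C(E, ℝ)) (n : ℕ) (x : Fin n → E) (c : Fin n → ℝ), (∀ i, 0 ≤ c i) →
      0 ≤ ∑ i, ∑ j, c i * c j * Q g g (x i, x j))
    (hvanish : ∀ (g : C(E, ℝ)) (x y : E), g x = 0 → g y = 0 → Q g g (x, y) = 0)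
    (g h : C(E, ℝ)) (x : E) : Q g h (x, x) = g x * h x * Q 1 1 (x, x) := by
  have red : ∀ g h : C(E, ℝ), Q g h (x, x) = g x * Q 1 h (x, x) := fun g h => by
    have h1 := eval_diag_eq_zero hsymm hcopos hvanish (g - g x • 1) h (x := x) (by simp)
    simp only [map_sub, map_smul, LinearMap.sub_apply, LinearMap.smul_apply,
      ContinuousMap.sub_apply, ContinuousMap.smul_apply, smul_eq_mul] at h1
    linarith
  rw [red, hsymm 1 h, red h 1]
  ring

theorem eval_eq_zero
    (hsymm : ∀ g h : C(E, ℝ), Q g h = Q h g)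
    (hsymval : ∀ (g h : C(E, ℝ)) (x y : E), Q g h (x, y) = Q g h (y, x))
    (hcopos : ∀ (g : C(E, ℝ)) (n : ℕ) (x : Fin n → E) (c : Fin n → ℝ), (∀ i, 0 ≤ c i) →
      0 ≤ ∑ i, ∑ j, c i * c j * Q g g (x i, x j))
    (hvanish : ∀ (g : C(E, ℝ)) (x y : E), g x = 0 → g y = 0 → Q g g (x, y) = 0)
    (g h : C(E, ℝ)) {x y : E} (hx : g x = 0) (hy : g y = 0) : Q g h (x, y) = 0 := by
  refine LinearMap.eq_zero_of_isotropic_of_boundedBelow (evalForm Q (x, y))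
    (K := (Q h h (x, x) + Q h h (y, y)) / 2) (fun g h => by simp [hsymm g h]) (fun t => ?_)
    (hvanish g x y hx hy)
  have h1 := eval_two_nonneg_of_copositive hsymval hcopos (h + t • g) x y zero_le_one
  rw [eval_diag hsymm hcopos hvanish _ _ x, eval_diag hsymm hcopos hvanish _ _ y] at h1
  rw [eval_diag hsymm hcopos hvanish h h x, eval_diag hsymm hcopos hvanish h h y, evalForm_apply]
  simp only [ContinuousMap.add_apply, ContinuousMap.smul_apply, hx, hy, smul_zero, add_zero] at h1
  linarith

theorem eval_congr
    (hsymm : ∀ g h : C(E, ℝ), Q g h = Q h g)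
    (hsymval : ∀ (g h : C(E, ℝ)) (x y : E), Q g h (x, y) = Q g h (y, x))
    (hcopos : ∀ (g : C(E, ℝ)) (n : ℕ) (x : Fin n → E) (c : Fin n → ℝ), (∀ i, 0 ≤ c i) →
      0 ≤ ∑ i, ∑ j, c i * c j * Q g g (x i, x j))
    (hvanish : ∀ (g : C(E, ℝ)) (x y : E), g x = 0 → g y = 0 → Q g g (x, y) = 0)
    {g g' h h' : C(E, ℝ)} {x y : E} (hgx : g x = g' x) (hgy : g y = g' y)
    (hhx : h x = h' x) (hhy : h y = h' y) : Q g h (x, y) = Q g' h' (x, y) := by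
  have h1 := eval_eq_zero hsymm hsymval hcopos hvanish (g - g') h (x := x) (y := y)
    (by simp [hgx]) (by simp [hgy])
  have h2 := eval_eq_zero hsymm hsymval hcopos hvanish (h - h') g' (x := x) (y := y)
    (by simp [hhx]) (by simp [hhy])
  simp only [map_sub, LinearMap.sub_apply, ContinuousMap.sub_apply] at h1 h2
  rw [hsymm h, hsymm h'] at h2
  linarith

/-- Two distinct points have neighbourhoods separated by a continuous function into `[0, 1]`. -/
theorem exists_continuousMap_eventually_one_zero {x y : E} (hxy : x ≠ y) :
    ∃ f : C(E, ℝ), (∀ᶠ z in 𝓝 x, f z = 1) ∧ (∀ᶠ z in 𝓝 y, f z = 0) ∧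
      ∀ z, f z ∈ Set.Icc (0 : ℝ) 1 := by
  have hd : 0 < dist x y / 3 := by have := dist_pos.2 hxy; positivity
  have hdisj : Disjoint (Metric.closedBall y (dist x y / 3)) (Metric.closedBall x (dist x y / 3)) :=
    Metric.closedBall_disjoint_closedBall (by rw [dist_comm y x]; linarith)
  obtain ⟨f, h0, h1, h⟩ := exists_continuous_zero_one_of_isClosed Metric.isClosed_closedBall
    Metric.isClosed_closedBall hdisj
  exact ⟨f, Filter.mem_of_superset (Metric.closedBall_mem_nhds x hd) fun z hz => h1 hz,
    Filter.mem_of_superset (Metric.closedBall_mem_nhds y hd) fun z hz => h0 hz, h⟩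

theorem exists_isBetaPiRep
    (hsymm : ∀ g h : C(E, ℝ), Q g h = Q h g)
    (hsymval : ∀ (g h : C(E, ℝ)) (x y : E), Q g h (x, y) = Q g h (y, x))
    (hcopos : ∀ (g : C(E, ℝ)) (n : ℕ) (x : Fin n → E) (c : Fin n → ℝ), (∀ i, 0 ≤ c i) →
      0 ≤ ∑ i, ∑ j, c i * c j * Q g g (x i, x j))
    (hvanish : ∀ (g : C(E, ℝ)) (x y : E), g x = 0 → g y = 0 → Q g g (x, y) = 0) :
    ∃ π β : E × E → ℝ, (∀ x, π (x, x) = 0) ∧ (∀ x y, β (x, y) = β (y, x)) ∧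
      IsBetaPiRep Q π β := by
  classical
  have hex : ∀ x y : E, ∃ f : C(E, ℝ), x ≠ y → f x = 1 ∧ f y = 0 := fun x y => by
    by_cases hxy : x = y
    · exact ⟨0, fun h => (h hxy).elim⟩
    · obtain ⟨f, h1, h0, -⟩ := exists_continuousMap_eventually_one_zero hxy
      exact ⟨f, fun _ => ⟨h1.self_of_nhds, h0.self_of_nhds⟩⟩
  choose φ hφ using hex
  have congr := @eval_congr E _ Q hsymm hsymval hcopos hvanish
  refine ⟨fun p => if p.1 = p.2 then 0 else 2 * Q (φ p.1 p.2) (φ p.1 p.2) p,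
    fun p => if p.1 = p.2 then Q 1 1 p else 2 * Q (φ p.1 p.2) (1 - φ p.1 p.2) p,
    by simp, fun x y => ?_, fun g h x y => ?_⟩
  · by_cases hxy : x = y
    · simp [hxy]
    · obtain ⟨h1, h2⟩ := hφ x y hxy
      obtain ⟨h3, h4⟩ := hφ y x (Ne.symm hxy)
      simp only [hxy, Ne.symm hxy, if_false]
      rw [hsymval _ _ y x, hsymm (φ y x), congr] <;> simp [h1, h2, h3, h4]
  · by_cases hxy : x = y
    · subst hxy
      simp only [if_true, eval_diag hsymm hcopos hvanish g h]
      ring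
    · obtain ⟨h1, h2⟩ := hφ x y hxy
      obtain ⟨h3, h4⟩ := hφ y x (Ne.symm hxy)
      simp only [hxy, Ne.symm hxy, if_false]
      have e1 : Q (φ y x) (φ y x) (y, x) = Q (1 - φ x y) (1 - φ x y) (x, y) := by
        rw [hsymval, congr] <;> simp [h1, h2, h3, h4]
      have e2 : Q g h (x, y) = Q (g x • φ x y + g y • (1 - φ x y))
          (h x • φ x y + h y • (1 - φ x y)) (x, y) := by
        apply congr <;> simp [h1, h2]
      rw [e1, e2]
      simp only [map_add (Q), map_smul (Q), map_add (Q _), map_smul (Q _), LinearMap.add_apply,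
        LinearMap.smul_apply, ContinuousMap.add_apply, ContinuousMap.smul_apply, smul_eq_mul,
        hsymm (1 - φ x y) (φ x y)]
      ring

namespace IsBetaPiRep

variable {π β : E × E → ℝ}

theorem eval_left (hrep : IsBetaPiRep Q π β) {f : C(E, ℝ)} {x y : E} (hx : f x = 1)
    (hy : f y = 0) : π (x, y) = 2 * Q f f (x, y) := by
  rw [hrep, hx, hy]
  ring

theorem eval_mixed (hrep : IsBetaPiRep Q π β) {f : C(E, ℝ)} {x y : E} (hx : f x = 1)
    (hy : f y = 0) : β (x, y) = 2 * Q f (1 - f) (x, y) := by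
  rw [hrep]
  simp [hx, hy]

theorem eval_self (hrep : IsBetaPiRep Q π β) (hdiag : ∀ x, π (x, x) = 0) (x : E) :
    β (x, x) = Q 1 1 (x, x) := by
  have h1 := hrep 1 1 x x
  simp [hdiag] at h1
  linarith

theorem pi_nonneg (hrep : IsBetaPiRep Q π β) (hdiag : ∀ x, π (x, x) = 0)
    (hsymval : ∀ (g h : C(E, ℝ)) (x y : E), Q g h (x, y) = Q g h (y, x))
    (hcopos : ∀ (g : C(E, ℝ)) (n : ℕ) (x : Fin n → E) (c : Fin n → ℝ), (∀ i, 0 ≤ c i) →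
      0 ≤ ∑ i, ∑ j, c i * c j * Q g g (x i, x j)) (p : E × E) : 0 ≤ π p := by
  obtain ⟨x, y⟩ := p
  by_cases hxy : x = y
  · simp [hxy, hdiag]
  obtain ⟨f, h1, h0, -⟩ := exists_continuousMap_eventually_one_zero hxy
  have key := hrep.eval_left h1.self_of_nhds h0.self_of_nhds
  have hyy : Q f f (y, y) = 0 := by
    have := hrep f f y y
    simp only [h0.self_of_nhds] at this
    linarith
  by_contra! hneg
  have hxx := eval_nonneg_of_copositive hcopos f x
  have h2 := eval_two_nonneg_of_copositive hsymval hcopos f x y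
    (c := (Q f f (x, x) + 1) / -π (x, y)) (div_nonneg (by linarith) (by linarith))
  have h3 : 2 * ((Q f f (x, x) + 1) / -π (x, y)) * Q f f (x, y) = -(Q f f (x, x) + 1) := by
    rw [show 2 * ((Q f f (x, x) + 1) / -π (x, y)) * Q f f (x, y) =
      (Q f f (x, x) + 1) / -π (x, y) * (2 * Q f f (x, y)) by ring, ← key]
    have := hneg.ne
    field_simp
  rw [h3, hyy] at h2
  linarith

theorem continuousOn (hrep : IsBetaPiRep Q π β) :
    ContinuousOn π {p : E × E | p.1 ≠ p.2} ∧ ContinuousOn β {p : E × E | p.1 ≠ p.2} := by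
  have key : ∀ p ∈ {p : E × E | p.1 ≠ p.2}, ContinuousAt π p ∧ ContinuousAt β p := by
    rintro ⟨x, y⟩ hxy
    obtain ⟨f, h1, h0, -⟩ := exists_continuousMap_eventually_one_zero hxy
    have hev : ∀ᶠ p : E × E in 𝓝 (x, y), f p.1 = 1 ∧ f p.2 = 0 := by
      rw [nhds_prod_eq]
      exact h1.prod_mk h0
    constructor
    · refine ContinuousAt.congr (f := fun p => 2 * Q f f p) (by fun_prop) ?_
      filter_upwards [hev] with p hp
      exact (hrep.eval_left hp.1 hp.2).symm
    · refine ContinuousAt.congr (f := fun p => 2 * Q f (1 - f) p) (by fun_prop) ?_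
      filter_upwards [hev] with p hp
      exact (hrep.eval_mixed hp.1 hp.2).symm
  exact ⟨fun p hp => (key p hp).1.continuousWithinAt, fun p hp => (key p hp).2.continuousWithinAt⟩

theorem continuous_sum (hrep : IsBetaPiRep Q π β) :
    Continuous (fun p : E × E => π p + π (p.2, p.1) + 2 * β p) := by
  have h : (fun p : E × E => π p + π (p.2, p.1) + 2 * β p) = fun p => 2 * Q 1 1 p := by
    funext ⟨x, y⟩
    rw [hrep]
    simp
    ring
  rw [h]
  fun_prop

theorem symm (hrep : IsBetaPiRep Q π β) (g h : C(E, ℝ)) (p : E × E) : Q g h p = Q h g p := by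
  obtain ⟨x, y⟩ := p
  have h1 := hrep g h x y
  have h2 := hrep h g x y
  linarith

theorem exists_continuousLinearMap (hrep : IsBetaPiRep Q π β) (p : E × E) (h : C(E, ℝ)) :
    ∃ L : C(E, ℝ) →L[ℝ] ℝ, ∀ g, L g = Q g h p := by
  obtain ⟨x, y⟩ := p
  refine ⟨((π (x, y) * h x + β (x, y) * h y) / 2) • ContinuousMap.evalCLM ℝ x +
    ((π (y, x) * h y + β (x, y) * h x) / 2) • ContinuousMap.evalCLM ℝ y, fun g => ?_⟩
  have h1 := hrep g h x y
  simp
  linarith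

/-- By the uniform boundedness principle, `Q` is automatically a bounded bilinear map. -/
theorem exists_bound [CompactSpace E] (hrep : IsBetaPiRep Q π β) :
    ∃ C : ℝ, ∀ (g h : C(E, ℝ)) (p : E × E), ‖g‖ ≤ 1 → ‖h‖ ≤ 1 → |Q g h p| ≤ C := by
  choose L hL using hrep.exists_continuousLinearMap
  have hfix : ∀ h, ∃ C, ∀ p, ‖L p h‖ ≤ C := fun h =>
    banach_steinhaus fun g => ⟨‖Q g h‖, fun p => by rw [hL]; exact (Q g h).norm_coe_le_norm p⟩
  have hunif : ∃ C, ∀ i : (E × E) × Metric.closedBall (0 : C(E, ℝ)) 1, ‖L i.1 i.2‖ ≤ C := by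
    refine banach_steinhaus fun g => ?_
    obtain ⟨C, hC⟩ := hfix g
    refine ⟨C, fun ⟨p, h, hh⟩ => ?_⟩
    rw [hL, hrep.symm, ← hL]
    exact (L p g).le_of_opNorm_le_of_le (hC p) (mem_closedBall_zero_iff.1 hh) |>.trans_eq
      (mul_one C)
  obtain ⟨C, hC⟩ := hunif
  refine ⟨C, fun g h p hg hh => ?_⟩
  rw [← hL, ← Real.norm_eq_abs]
  exact (L p h).le_of_opNorm_le_of_le (hC (p, ⟨h, mem_closedBall_zero_iff.2 hh⟩)) hg |>.trans_eq
    (mul_one C)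

theorem bounded [CompactSpace E] (hrep : IsBetaPiRep Q π β) (hdiag : ∀ x, π (x, x) = 0) :
    ∃ C : ℝ, ∀ p, |π p| ≤ C ∧ |β p| ≤ C := by
  obtain ⟨C, hunit⟩ := hrep.exists_bound
  have hnorm : ∀ f : C(E, ℝ), (∀ z, f z ∈ Set.Icc (0 : ℝ) 1) → ‖f‖ ≤ 1 := fun f hf =>
    (ContinuousMap.norm_le f zero_le_one).2 fun z => by
      rw [Real.norm_eq_abs, abs_of_nonneg (hf z).1]
      exact (hf z).2
  refine ⟨2 * C, fun ⟨x, y⟩ => ?_⟩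
  by_cases hxy : x = y
  · subst hxy
    have hone := hunit 1 1 (x, x) (hnorm 1 (by simp)) (hnorm 1 (by simp))
    rw [hdiag, hrep.eval_self hdiag, abs_zero]
    have := (abs_nonneg _).trans hone
    constructor <;> linarith
  · obtain ⟨f, h1, h0, hf⟩ := exists_continuousMap_eventually_one_zero hxy
    have hfc : ‖1 - f‖ ≤ 1 := hnorm _ fun z => by
      have := hf z
      simp only [ContinuousMap.sub_apply, ContinuousMap.one_apply, Set.mem_Icc] at this ⊢
      constructor <;> linarith [this.1, this.2]
    rw [hrep.eval_left h1.self_of_nhds h0.self_of_nhds,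
      hrep.eval_mixed h1.self_of_nhds h0.self_of_nhds, abs_mul, abs_mul, abs_two]
    exact ⟨mul_le_mul_of_nonneg_left (hunit _ _ _ (hnorm f hf) (hnorm f hf)) zero_le_two,
      mul_le_mul_of_nonneg_left (hunit _ _ _ (hnorm f hf) hfc) zero_le_two⟩

end IsBetaPiRep

/-- A prescribed function is interpolated on a finite set by a continuous one. -/
theorem exists_continuousMap_eqOn_finite {s : Set E} (hs : s.Finite) (U : E → ℝ) :
    ∃ g : C(E, ℝ), ∀ z ∈ s, g z = U z := by
  have := hs.to_subtype
  obtain ⟨g, hg⟩ := ContinuousMap.exists_restrict_eq hs.isClosed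
    ⟨fun z : s => U z, continuous_of_discreteTopology⟩
  exact ⟨g, fun z hz => DFunLike.congr_fun hg ⟨z, hz⟩⟩

end Representation

/-- Weighted averaging over the fibres of `x` preserves integrals of functions of `x`. -/
theorem exists_fiberwise_average {ι α : Type*} [Fintype ι] (x : ι → α) (c v : ι → ℝ)
    (hc : ∀ i, 0 < c i) :
    ∃ U : α → ℝ, ∀ F : α → ℝ, ∑ i, c i * U (x i) * F (x i) = ∑ i, v i * F (x i) := by
  classical
  refine ⟨fun z => (∑ i with x i = z, v i) / ∑ i with x i = z, c i, fun F => ?_⟩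
  have hmaps : ∀ i ∈ Finset.univ, x i ∈ Finset.univ.image x := by simp
  rw [← Finset.sum_fiberwise_of_maps_to hmaps, ← Finset.sum_fiberwise_of_maps_to hmaps]
  refine Finset.sum_congr rfl fun z hz => ?_
  obtain ⟨k, -, rfl⟩ := Finset.mem_image.1 hz
  have hpos : 0 < ∑ i with x i = x k, c i :=
    Finset.sum_pos (fun i _ => hc i) ⟨k, by simp⟩
  calc ∑ i with x i = x k, c i * ((∑ j with x j = x i, v j) / ∑ j with x j = x i, c j) * F (x i)
      = ∑ i with x i = x k,
          c i * (((∑ j with x j = x k, v j) / ∑ j with x j = x k, c j) * F (x k)) :=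
        Finset.sum_congr rfl fun i hi => by rw [(Finset.mem_filter.1 hi).2, mul_assoc]
    _ = ∑ i with x i = x k, v i * F (x k) := by
        rw [← Finset.sum_mul, ← Finset.sum_mul]
        field_simp
    _ = ∑ i with x i = x k, v i * F (x i) :=
        Finset.sum_congr rfl fun i hi => by rw [(Finset.mem_filter.1 hi).2]

theorem IsBetaPiRep.posSemidef {E : Type*} [MetricSpace E]
    {Q : C(E, ℝ) →ₗ[ℝ] C(E, ℝ) →ₗ[ℝ] C(E × E, ℝ)} {π β : E × E → ℝ} (hrep : IsBetaPiRep Q π β)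
    (hπ : ∀ p, 0 ≤ π p)
    (hcopos : ∀ (g : C(E, ℝ)) (n : ℕ) (x : Fin n → E) (c : Fin n → ℝ), (∀ i, 0 ≤ c i) →
      0 ≤ ∑ i, ∑ j, c i * c j * Q g g (x i, x j))
    (n : ℕ) (x : Fin n → E) (c : Fin n → ℝ) (hc : ∀ i, 0 < c i) (v : Fin n → ℝ) :
    0 ≤ ∑ i, ∑ j, v i * v j *
      (β (x i, x j) + if i = j then ∑ k, (c k / c i) * π (x i, x k) else 0) := by
  obtain ⟨U, hU⟩ := exists_fiberwise_average x c v hc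
  obtain ⟨g, hg⟩ := exists_continuousMap_eqOn_finite (Set.finite_range x) U
  have hgx : ∀ i, g (x i) = U (x i) := fun i => hg _ ⟨i, rfl⟩
  have h0 := hcopos g n x c fun i => (hc i).le
  have hsplit : ∑ i, ∑ j, c i * c j * Q g g (x i, x j) =
      ∑ i, ∑ j, c i * U (x i) ^ 2 * (c j * π (x i, x j)) +
        ∑ i, ∑ j, c i * U (x i) * (c j * U (x j) * β (x i, x j)) := by
    have hswap : ∑ i, ∑ j, c i * U (x i) ^ 2 * (c j * π (x i, x j)) =
        ∑ i, ∑ j, c j * U (x j) ^ 2 * (c i * π (x j, x i)) := Finset.sum_comm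
    have hdouble : 2 * ∑ i, ∑ j, c i * c j * Q g g (x i, x j) =
        ∑ i, ∑ j, c i * U (x i) ^ 2 * (c j * π (x i, x j)) +
        ∑ i, ∑ j, c j * U (x j) ^ 2 * (c i * π (x j, x i)) +
        2 * ∑ i, ∑ j, c i * U (x i) * (c j * U (x j) * β (x i, x j)) := by
      simp only [Finset.mul_sum, ← Finset.sum_add_distrib]
      refine Finset.sum_congr rfl fun i _ => Finset.sum_congr rfl fun j _ => ?_
      rw [show 2 * (c i * c j * Q g g (x i, x j)) = c i * c j * (2 * Q g g (x i, x j)) by ring,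
        hrep, hgx, hgx]
      ring
    linarith
  have hβ : ∑ i, ∑ j, c i * U (x i) * (c j * U (x j) * β (x i, x j)) =
      ∑ i, ∑ j, v i * v j * β (x i, x j) := by
    calc ∑ i, ∑ j, c i * U (x i) * (c j * U (x j) * β (x i, x j))
        = ∑ i, c i * U (x i) * ∑ j, v j * β (x i, x j) := by
          refine Finset.sum_congr rfl fun i _ => ?_
          rw [← Finset.mul_sum, hU fun z => β (x i, z)]
      _ = ∑ i, v i * ∑ j, v j * β (x i, x j) := hU fun z => ∑ j, v j * β (z, x j)
      _ = _ := by simp only [Finset.mul_sum, mul_assoc]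
  have hpi : ∑ i, ∑ j, c i * U (x i) ^ 2 * (c j * π (x i, x j)) ≤
      ∑ i, v i ^ 2 * ∑ k, (c k / c i) * π (x i, x k) := by
    have hproj := hU fun z => U z * ∑ j, c j * π (z, x j)
    calc ∑ i, ∑ j, c i * U (x i) ^ 2 * (c j * π (x i, x j))
        = ∑ i, (2 * (v i * (U (x i) * ∑ j, c j * π (x i, x j))) -
            c i * U (x i) * (U (x i) * ∑ j, c j * π (x i, x j))) := by
          rw [Finset.sum_sub_distrib, ← Finset.mul_sum, hproj, two_mul, add_sub_cancel_right,
            ← hproj]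
          refine Finset.sum_congr rfl fun i _ => ?_
          rw [← Finset.mul_sum]
          ring
      _ ≤ ∑ i, v i ^ 2 / c i * ∑ k, c k * π (x i, x k) := by
          refine Finset.sum_le_sum fun i _ => ?_
          have hS : 0 ≤ ∑ k, c k * π (x i, x k) :=
            Finset.sum_nonneg fun k _ => mul_nonneg (hc k).le (hπ _)
          have hsq : 2 * (v i * U (x i)) - c i * U (x i) ^ 2 ≤ v i ^ 2 / c i := by
            rw [le_div_iff₀ (hc i)]
            nlinarith [sq_nonneg (v i - c i * U (x i))]
          nlinarith [mul_le_mul_of_nonneg_right hsq hS]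
      _ = _ := by
          refine Finset.sum_congr rfl fun i _ => ?_
          simp only [Finset.mul_sum]
          refine Finset.sum_congr rfl fun k _ => ?_
          ring
  have hgoal : ∑ i, ∑ j, v i * v j *
      (β (x i, x j) + if i = j then ∑ k, (c k / c i) * π (x i, x k) else 0) =
      ∑ i, ∑ j, v i * v j * β (x i, x j) + ∑ i, v i ^ 2 * ∑ k, (c k / c i) * π (x i, x k) := by
    rw [← Finset.sum_add_distrib]
    refine Finset.sum_congr rfl fun i _ => ?_
    simp only [mul_add, Finset.sum_add_distrib, mul_ite, mul_zero, Finset.sum_ite_eq,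
      Finset.mem_univ, if_true]
    ring
  rw [hgoal]
  linarith

/-- If `Q₂(g,g)` is a copositive kernel for every `g` and vanishes at `(x,y)` whenever
`g(x) = g(y) = 0`, then `Q₂` admits a `(β,π)`-representation. -/
theorem stmt_6 {E : Type*} [MetricSpace E] [CompactSpace E]
    (Q₂ : C(E, ℝ) →ₗ[ℝ] C(E, ℝ) →ₗ[ℝ] C(E × E, ℝ))
    (hsymm : ∀ g h : C(E, ℝ), Q₂ g h = Q₂ h g)
    (hsymval : ∀ (g h : C(E, ℝ)) (x y : E), Q₂ g h (x, y) = Q₂ g h (y, x))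
    (hcopos : ∀ (g : C(E, ℝ)) (n : ℕ) (x : Fin n → E) (c : Fin n → ℝ), (∀ i, 0 ≤ c i) →
      0 ≤ ∑ i, ∑ j, c i * c j * Q₂ g g (x i, x j))
    (hvanish : ∀ (g : C(E, ℝ)) (x y : E), g x = 0 → g y = 0 → Q₂ g g (x, y) = 0) :
    ∃ π β : E × E → ℝ,
      (∀ p, 0 ≤ π p) ∧ (∀ x : E, π (x, x) = 0) ∧
      (∀ x y : E, β (x, y) = β (y, x)) ∧ (∀ x : E, 0 ≤ β (x, x)) ∧
      (∃ C : ℝ, ∀ p, |π p| ≤ C ∧ |β p| ≤ C) ∧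
      ContinuousOn π {p : E × E | p.1 ≠ p.2} ∧
      ContinuousOn β {p : E × E | p.1 ≠ p.2} ∧
      Continuous (fun p : E × E => π p + π (p.2, p.1) + 2 * β p) ∧
      (∀ (g : C(E, ℝ)) (x y : E),
        Q₂ g g (x, y) =
          (1 / 2) * (π (x, y) * g x ^ 2 + π (y, x) * g y ^ 2 + 2 * β (x, y) * g x * g y)) ∧
      (∀ (n : ℕ) (x : Fin n → E) (c : Fin n → ℝ), (∀ i, 0 < c i) →
        ∀ v : Fin n → ℝ,
          0 ≤ ∑ i, ∑ j, v i * v j *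
            (β (x i, x j) + if i = j then ∑ k, (c k / c i) * π (x i, x k) else 0)) := by
  obtain ⟨π, β, hdiag, hβ, hrep⟩ := exists_isBetaPiRep hsymm hsymval hcopos hvanish
  have hπ := hrep.pi_nonneg hdiag hsymval hcopos
  refine ⟨π, β, hπ, hdiag, hβ, fun x => ?_, hrep.bounded hdiag, hrep.continuousOn.1,
    hrep.continuousOn.2, hrep.continuous_sum, fun g x y => ?_, hrep.posSemidef hπ hcopos⟩
  · rw [hrep.eval_self hdiag]
    exact eval_nonneg_of_copositive hcopos 1 x
  · have h1 := hrep g g x y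
    linarith
end

section
/- Let E be a compact metric space and let B : C(E) → C(E) be a linear operator. Then B satisfies the positive minimum principle on E (i.e., Bg(x) ≥ 0 whenever g ∈ C(E), g ≥ 0, x ∈ E and g(x) = 0) if and only if there exist m ∈ C(E) and a finite nonnegative kernel ν_B from E to E (a measurable family x ↦ ν_B(x,·) of nonnegative Borel measures on E with sup_x ν_B(x,E) < ∞) such that Bg(x) = ∫_E (g(ξ) − g(x)) ν_B(x,dξ) + m(x)g(x) for all g ∈ C(E) and x ∈ E. In that case B is a bounded operator. -/
open MeasureTheory Topology
open scoped NNReal ENNReal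

/-- The positive minimum principle for a linear operator on `C(E, ℝ)`. -/
def PositiveMinimumPrinciple {E : Type*} [TopologicalSpace E]
    (B : C(E, ℝ) →ₗ[ℝ] C(E, ℝ)) : Prop :=
  ∀ g : C(E, ℝ), (∀ x, 0 ≤ g x) → ∀ x : E, g x = 0 → 0 ≤ B g x

namespace PositiveMinimumPrinciple

variable {E : Type*} [TopologicalSpace E] {B : C(E, ℝ) →ₗ[ℝ] C(E, ℝ)}

/-- At a point where `f` attains its maximum, `B f ≤ f * B 1`. -/
lemma apply_le_of_isMax (hB : PositiveMinimumPrinciple B) {f : C(E, ℝ)} {x : E}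
    (hx : ∀ y, f y ≤ f x) : B f x ≤ f x * B 1 x := by
  have h := hB (f x • 1 - f) (fun y ↦ by simpa using hx y) x (by simp)
  simpa using h

variable [CompactSpace E]

/-- The operator `A f = B f - B 1 * f` is dissipative. -/
lemma norm_le_norm_sub_smul (hB : PositiveMinimumPrinciple B) (f : C(E, ℝ)) {t : ℝ}
    (ht : 0 ≤ t) : ‖f‖ ≤ ‖f - t • (B f - B 1 * f)‖ := by
  have key : ∀ (g : C(E, ℝ)) (x : E), (∀ y, |g y| ≤ g x) →
      g x ≤ ‖g - t • (B g - B 1 * g)‖ := by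
    intro g x hx
    have h1 := hB.apply_le_of_isMax (f := g) (x := x) fun y ↦ (le_abs_self _).trans (hx y)
    have h2 := (le_abs_self _).trans ((g - t • (B g - B 1 * g)).norm_coe_le_norm x)
    simp only [ContinuousMap.sub_apply, ContinuousMap.smul_apply, ContinuousMap.mul_apply,
      smul_eq_mul] at h2
    nlinarith [mul_nonneg ht (sub_nonneg.2 h1)]
  rcases isEmpty_or_nonempty E with hE | hE
  · rw [Subsingleton.elim f 0]
    simp
  obtain ⟨x, -, hx⟩ := isCompact_univ.exists_isMaxOn Set.univ_nonempty
    (f := fun y ↦ |f y|) (by fun_prop)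
  replace hx : ∀ y, |f y| ≤ |f x| := fun y ↦ hx (Set.mem_univ y)
  refine ((ContinuousMap.norm_le f (abs_nonneg _)).2 hx).trans ?_
  rcases abs_cases (f x) with ⟨h, -⟩ | ⟨h, -⟩
  · rw [h]
    exact key f x fun y ↦ h ▸ hx y
  · have h' := key (-f) x fun y ↦ by simpa [h] using hx y
    rw [h]
    refine h'.trans_eq ?_
    rw [← norm_neg]
    congr 1
    rw [map_neg, mul_neg]
    module

/-- A linear operator on `C(E, ℝ)` satisfying the positive minimum principle is continuous. -/
lemma continuous (hB : PositiveMinimumPrinciple B) : Continuous B := by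
  set A : C(E, ℝ) →ₗ[ℝ] C(E, ℝ) := B - LinearMap.mulLeft ℝ (B 1) with hA
  have hdiss : ∀ (f : C(E, ℝ)) {t : ℝ}, 0 ≤ t → ‖f‖ ≤ ‖f - t • A f‖ :=
    fun f t ht ↦ hB.norm_le_norm_sub_smul f ht
  have hcont : Continuous A := by
    refine A.continuous_of_seq_closed_graph fun u f y hu hAu ↦ ?_
    rw [← sub_eq_zero]
    set z := y - A f
    have hlim : Filter.Tendsto (fun n ↦ A (u n - f)) Filter.atTop (𝓝 z) := by
      simpa [z] using hAu.sub_const (A f)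
    have hlim0 : Filter.Tendsto (fun n ↦ u n - f) Filter.atTop (𝓝 0) := by
      simpa using hu.sub_const f
    have hs : ∀ s : ℝ, 0 < s → ‖z‖ ≤ s * ‖A z‖ := by
      intro s hs
      have hle : ‖(0 : C(E, ℝ)) + s • z‖ ≤ ‖0 + s • z - s • (z + s • A z)‖ := by
        refine le_of_tendsto_of_tendsto' (hlim0.add_const (s • z)).norm
          ((hlim0.add_const (s • z)).sub ((hlim.add_const (s • A z)).const_smul s)).norm
          fun n ↦ ?_
        have h := hdiss (u n - f + s • z) hs.le
        rwa [map_add, map_smul] at h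
      rw [zero_add, show s • z - s • (z + s • A z) = -(s • s • A z) by module, norm_neg,
        norm_smul, norm_smul, Real.norm_of_nonneg hs.le] at hle
      exact (mul_le_mul_iff_right₀ hs).1 (by simpa [norm_smul, abs_of_pos hs] using hle)
    have htend : Filter.Tendsto (fun s : ℝ ↦ s * ‖A z‖) (𝓝[>] 0) (𝓝 0) := by
      have : Continuous fun s : ℝ ↦ s * ‖A z‖ := by fun_prop
      simpa using (this.tendsto 0).mono_left nhdsWithin_le_nhds
    exact norm_le_zero_iff.1 (ge_of_tendsto htend (eventually_mem_nhdsWithin.mono hs))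
  have hBA : ⇑B = fun f ↦ A f + B 1 * f := by
    ext f
    simp [hA]
  rw [hBA]
  fun_prop

lemma exists_norm_le (hB : PositiveMinimumPrinciple B) :
    ∃ C : ℝ, 0 ≤ C ∧ ∀ g : C(E, ℝ), ‖B g‖ ≤ C * ‖g‖ :=
  ⟨‖(⟨B, hB.continuous⟩ : C(E, ℝ) →L[ℝ] C(E, ℝ))‖, ContinuousLinearMap.opNorm_nonneg _,
    ContinuousLinearMap.le_opNorm (⟨B, hB.continuous⟩ : C(E, ℝ) →L[ℝ] C(E, ℝ))⟩

/-- If `‖B g‖ ≤ C ‖g‖` for all `g`, then `B + C` is a positive operator. -/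
lemma apply_add_mul_nonneg (hB : PositiveMinimumPrinciple B) {C : ℝ}
    (hC : ∀ g : C(E, ℝ), ‖B g‖ ≤ C * ‖g‖) (hC0 : 0 ≤ C) {g : C(E, ℝ)} (hg : ∀ x, 0 ≤ g x)
    (x : E) : 0 ≤ B g x + C * g x := by
  set k : C(E, ℝ) := g ⊓ ContinuousMap.const E (g x) with hk
  have h1 : 0 ≤ B (g - k) x := hB _ (fun y ↦ by simp [hk]) x (by simp [hk])
  have hkn : ‖k‖ ≤ g x := by
    refine (ContinuousMap.norm_le k (hg x)).2 fun y ↦ ?_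
    rw [Real.norm_of_nonneg (by simp [hk, hg])]
    simp [hk]
  have h2 := (neg_le_abs _).trans ((B k).norm_coe_le_norm x)
  rw [map_sub, ContinuousMap.sub_apply] at h1
  nlinarith [hC k, mul_le_mul_of_nonneg_left hkn hC0]

end PositiveMinimumPrinciple

/-- The Riesz–Markov–Kakutani theorem for a positive linear functional on `C(X, ℝ)`,
`X` compact. -/
lemma exists_isFiniteMeasure_forall_integral_eq {X : Type*} [TopologicalSpace X] [T2Space X]
    [CompactSpace X] [MeasurableSpace X] [BorelSpace X] (Λ : C(X, ℝ) →ₗ[ℝ] ℝ)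
    (hΛ : ∀ g : C(X, ℝ), (∀ x, 0 ≤ g x) → 0 ≤ Λ g) :
    ∃ μ : Measure X, IsFiniteMeasure μ ∧ ∀ g : C(X, ℝ), ∫ x, g x ∂μ = Λ g := by
  let L : CompactlySupportedContinuousMap X ℝ →ₗ[ℝ] ℝ :=
    { toFun := fun f ↦ Λ f.toContinuousMap
      map_add' := fun f g ↦ Λ.map_add f.toContinuousMap g.toContinuousMap
      map_smul' := fun c f ↦ Λ.map_smul c f.toContinuousMap }
  let P := PositiveLinearMap.mk₀ L fun f hf ↦ hΛ f.toContinuousMap hf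
  refine ⟨RealRMK.rieszMeasure P, inferInstance, fun g ↦ ?_⟩
  exact RealRMK.integral_rieszMeasure P (CompactlySupportedContinuousMap.continuousMapEquiv g)

/-- A family of finite measures is measurable as soon as the integrals of bounded continuous
nonnegative functions are measurable. -/
lemma measurable_measure_of_forall_lintegral {α X : Type*} [MeasurableSpace α]
    [TopologicalSpace X] [HasOuterApproxClosed X] [MeasurableSpace X] [BorelSpace X]
    {κ : α → Measure X} [∀ a, IsFiniteMeasure (κ a)]
    (h : ∀ f : BoundedContinuousFunction X ℝ≥0, Measurable fun a ↦ ∫⁻ x, f x ∂κ a) :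
    Measurable κ := by
  have hclosed : ∀ F : Set X, IsClosed F → Measurable fun a ↦ κ a F := fun F hF ↦
    measurable_of_tendsto_metrizable (fun n ↦ h (hF.apprSeq n))
      (tendsto_pi_nhds.2 fun a ↦ HasOuterApproxClosed.tendsto_lintegral_apprSeq hF (κ a))
  exact .measure_of_isPiSystem (BorelSpace.measurable_eq.trans borel_eq_generateFrom_isClosed)
    isPiSystem_isClosed hclosed (hclosed _ isClosed_univ)

/-- A linear operator `B` on `C(E)` (`E` compact metric) satisfies the positive minimum
principle if and only if it has the representation
`Bg(x) = ∫ (g(ξ) − g(x)) ν_B(x,dξ) + m(x)g(x)` for some `m ∈ C(E)` and a finite nonnegative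
kernel `ν_B`; in that case `B` is bounded. -/
theorem stmt_7 {E : Type*} [MetricSpace E] [CompactSpace E] [MeasurableSpace E] [BorelSpace E]
    (B : C(E, ℝ) →ₗ[ℝ] C(E, ℝ)) :
    ((∀ g : C(E, ℝ), (∀ x, 0 ≤ g x) → ∀ x : E, g x = 0 → 0 ≤ B g x) ↔
      (∃ (m : C(E, ℝ)) (κ : E → Measure E),
        Measurable κ ∧ (∃ C : ℝ≥0, ∀ x, κ x Set.univ ≤ (C : ℝ≥0∞)) ∧
        ∀ (g : C(E, ℝ)) (x : E),
          B g x = (∫ ξ, (g ξ - g x) ∂(κ x)) + m x * g x)) ∧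
    ((∀ g : C(E, ℝ), (∀ x, 0 ≤ g x) → ∀ x : E, g x = 0 → 0 ≤ B g x) →
      ∃ C : ℝ, ∀ g : C(E, ℝ), ‖B g‖ ≤ C * ‖g‖) := by
  refine ⟨⟨fun hB ↦ ?_, ?_⟩, fun hB ↦ ?_⟩
  · obtain ⟨C, hC0, hC⟩ := PositiveMinimumPrinciple.exists_norm_le hB
    have hrep : ∀ x : E, ∃ μ : Measure E, IsFiniteMeasure μ ∧
        ∀ g : C(E, ℝ), ∫ ξ, g ξ ∂μ = B g x + C * g x := fun x ↦
      exists_isFiniteMeasure_forall_integral_eq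
        { toFun := fun g ↦ B g x + C * g x
          map_add' := fun f g ↦ by simp; ring
          map_smul' := fun c f ↦ by simp; ring }
        fun g hg ↦ PositiveMinimumPrinciple.apply_add_mul_nonneg hB hC hC0 hg x
    choose κ hfin hκ using hrep
    have hmass : ∀ x, (κ x).real Set.univ = B 1 x + C := fun x ↦ by
      simpa using hκ x 1
    refine ⟨B 1, κ, measurable_measure_of_forall_lintegral fun f ↦ ?_, ?_, fun g x ↦ ?_⟩
    · let f' : C(E, ℝ) := ⟨fun x ↦ (f x : ℝ), by fun_prop⟩
      have hf : ∀ x, ∫⁻ ξ, f ξ ∂κ x = ENNReal.ofReal (B f' x + C * f' x) := fun x ↦ by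
        rw [← hκ x f', lintegral_coe_eq_integral]
        · rfl
        · exact f'.continuous.integrable_of_hasCompactSupport (.of_compactSpace f')
      simp_rw [hf]
      exact (ENNReal.continuous_ofReal.comp (by fun_prop)).measurable
    · refine ⟨(‖B 1‖ + C).toNNReal, fun x ↦ ?_⟩
      rw [← ofReal_measureReal, hmass]
      exact ENNReal.ofReal_le_ofReal
        (by linarith [(le_abs_self _).trans ((B 1).norm_coe_le_norm x)])
    · rw [integral_sub (g.continuous.integrable_of_hasCompactSupport (.of_compactSpace g))
        (integrable_const _), hκ, integral_const, hmass, smul_eq_mul]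
      ring
  · rintro ⟨m, κ, -, -, h⟩ g hg x hx
    simpa [h, hx] using integral_nonneg hg
  · obtain ⟨C, -, hC⟩ := PositiveMinimumPrinciple.exists_norm_le hB
    exact ⟨C, hC⟩
end

section
/- Let E be a compact metric space and let D be a dense linear subspace of C(E) containing the constant function 1. Equip M₊(E) with the topology of weak convergence (the coarsest topology making ν ↦ ∫_E g dν continuous for every g ∈ C(E)). Then the set F of functions f : M₊(E) → ℝ of the form f(ν) = φ(⟨g₁,ν⟩,…,⟨g_m,ν⟩) with m ∈ ℕ, φ : ℝ^m → ℝ smooth and compactly supported, and g₁,…,g_m ∈ D, such that f has compact support in M₊(E), is dense with respect to the supremum norm in C₀(M₊(E)), the space of continuous functions on M₊(E) vanishing at infinity. -/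
open MeasureTheory Topology

section helpers

variable {E : Type*} [MetricSpace E] [CompactSpace E] [MeasurableSpace E] [BorelSpace E]

lemma integrable_continuousMap (μ : Measure E) [IsFiniteMeasure μ] (g : C(E, ℝ)) :
    Integrable g μ :=
  g.continuous.integrable_of_hasCompactSupport (HasCompactSupport.of_compactSpace _)

lemma continuous_integral_left (μ : Measure E) [IsFiniteMeasure μ] :
    Continuous fun g : C(E, ℝ) => ∫ x, g x ∂μ := by
  refine (LipschitzWith.of_dist_le_mul (K := (μ.real Set.univ).toNNReal) fun f g => ?_).continuous
  rw [dist_eq_norm, ← integral_sub (integrable_continuousMap μ f) (integrable_continuousMap μ g),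
    Real.coe_toNNReal _ measureReal_nonneg, mul_comm]
  refine norm_integral_le_of_norm_le_const (Filter.Eventually.of_forall fun x => ?_)
  rw [← dist_eq_norm]
  exact ContinuousMap.dist_apply_le_dist x

lemma MeasureTheory.FiniteMeasure.ext_of_dense {D : Set C(E, ℝ)} (hD : Dense D) {μ ν : FiniteMeasure E}
    (h : ∀ g ∈ D, ∫ x, g x ∂(μ : Measure E) = ∫ x, g x ∂(ν : Measure E)) : μ = ν := by
  have key := Continuous.ext_on hD (continuous_integral_left (μ : Measure E))
    (continuous_integral_left (ν : Measure E)) h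
  exact FiniteMeasure.ext_of_forall_integral_eq fun f => congrFun key f.toContinuousMap

/-- On a compact set of finite measures, a continuous function is uniformly close to a polynomial
in finitely many integrals of functions from a dense set. -/
lemma exists_mvPolynomial_integral_near {D : Set C(E, ℝ)} (hD : Dense D)
    {K : Set (FiniteMeasure E)} (hK : IsCompact K) {h : FiniteMeasure E → ℝ} (hh : Continuous h)
    {ε : ℝ} (hε : 0 < ε) :
    ∃ (n : ℕ) (g : Fin n → C(E, ℝ)) (q : MvPolynomial (Fin n) ℝ), (∀ i, g i ∈ D) ∧
      ∀ ν ∈ K, |MvPolynomial.eval (fun i => ∫ x, g i x ∂(ν : Measure E)) q - h ν| < ε := by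
  have : CompactSpace K := isCompact_iff_compactSpace.mp hK
  let T : D → C(K, ℝ) := fun g => ⟨fun ν => ∫ x, g.1 x ∂((ν : FiniteMeasure E) : Measure E),
    (FiniteMeasure.continuous_integral_continuousMap g.1).comp continuous_subtype_val⟩
  let A : Subalgebra ℝ C(K, ℝ) := (MvPolynomial.aeval T).range
  have hA : A.SeparatesPoints := by
    intro μ ν hμν
    by_contra! hc
    refine hμν (Subtype.ext (FiniteMeasure.ext_of_dense hD fun g hg => ?_))
    exact hc _ ⟨T ⟨g, hg⟩, ⟨MvPolynomial.X ⟨g, hg⟩, by simp⟩, rfl⟩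
  obtain ⟨⟨_, p, rfl⟩, hp⟩ := ContinuousMap.exists_mem_subalgebra_near_continuous_of_separatesPoints
    A hA (fun ν : K => h ν) (hh.comp continuous_subtype_val) ε hε
  obtain ⟨n, f, -, q, rfl⟩ := MvPolynomial.exists_fin_rename p
  refine ⟨n, fun i => (f i).1, q, fun i => (f i).2, fun ν hν => ?_⟩
  have e : (MvPolynomial.aeval T (MvPolynomial.rename f q)) ⟨ν, hν⟩ =
      MvPolynomial.eval (fun i => ∫ x, (f i).1 x ∂(ν : Measure E)) q := by
    have hcomp := MvPolynomial.comp_aeval_apply (f := T)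
      (ContinuousMap.evalAlgHom ℝ ℝ (⟨ν, hν⟩ : K)) (MvPolynomial.rename f q)
    refine hcomp.trans ?_
    rw [MvPolynomial.aeval_rename, MvPolynomial.aeval_eq_eval]
    rfl
  rw [← e]
  exact hp ⟨ν, hν⟩

end helpers

/-- Cylindrical functions `ν ↦ φ(⟨g₁,ν⟩,…,⟨g_m,ν⟩)` with `φ` smooth and compactly supported,
coefficients `gᵢ` in a dense subspace `D ∋ 1` of `C(E)`, and compact support in `M₊(E)`, are
dense (in supremum norm) in `C₀(M₊(E))`. -/
theorem stmt_15 {E : Type*} [MetricSpace E] [CompactSpace E] [MeasurableSpace E] [BorelSpace E]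
    (D : Submodule ℝ C(E, ℝ)) (hD : Dense (D : Set C(E, ℝ))) (h1 : (1 : C(E, ℝ)) ∈ D) :
    ∀ (h : ZeroAtInftyContinuousMap (FiniteMeasure E) ℝ) (ε : ℝ), 0 < ε →
      ∃ (m : ℕ) (φ : (Fin m → ℝ) → ℝ) (g : Fin m → C(E, ℝ)),
        ContDiff ℝ (⊤ : ℕ∞) φ ∧ HasCompactSupport φ ∧ (∀ i, g i ∈ D) ∧
        HasCompactSupport
          (fun ν : FiniteMeasure E => φ (fun i => ∫ x, g i x ∂(ν : Measure E))) ∧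
        Continuous
          (fun ν : FiniteMeasure E => φ (fun i => ∫ x, g i x ∂(ν : Measure E))) ∧
        ∀ ν : FiniteMeasure E,
          |h ν - φ (fun i => ∫ x, g i x ∂(ν : Measure E))| ≤ ε := by
  intro h ε hε
  obtain ⟨K₀, hK₀, hsmall⟩ : ∃ K₀ : Set (FiniteMeasure E), IsCompact K₀ ∧
      ∀ ν ∉ K₀, |h ν| < ε := by
    have := h.zero_at_infty' (Metric.ball_mem_nhds 0 hε)
    obtain ⟨K₀, hK₀, hs⟩ := Filter.mem_cocompact.mp this
    exact ⟨K₀, hK₀, fun ν hν => by simpa using hs hν⟩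
  obtain ⟨R, hR⟩ : ∃ R : NNReal, ∀ ν ∈ K₀, ν.mass ≤ R := by
    obtain ⟨R, hR⟩ := (hK₀.image FiniteMeasure.continuous_mass).bddAbove
    exact ⟨R, fun ν hν => hR ⟨ν, hν, rfl⟩⟩
  have hK : IsCompact {ν : FiniteMeasure E | ν.mass ≤ R + 1} :=
    isCompact_setOfPred_finiteMeasure_le_of_compactSpace E (R + 1)
  obtain ⟨n, g, q, hg, hq⟩ := exists_mvPolynomial_integral_near hD hK h.continuous hε
  let G : Fin (n + 1) → C(E, ℝ) := Fin.cons 1 g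
  let L : FiniteMeasure E → Fin (n + 1) → ℝ := fun ν i => ∫ x, G i x ∂(ν : Measure E)
  have hL : Continuous L :=
    continuous_pi fun i => FiniteMeasure.continuous_integral_continuousMap (G i)
  have hL0 (ν : FiniteMeasure E) : L ν 0 = ν.mass := by
    simp [L, G, FiniteMeasure.mass]
  have hLs (ν : FiniteMeasure E) :
      (fun i : Fin n => L ν i.succ) = fun i => ∫ x, g i x ∂(ν : Measure E) := by
    simp [L, G]
  obtain ⟨r, hr, hLr⟩ : ∃ r : ℝ, 0 < r ∧ ∀ ν : FiniteMeasure E, ν.mass ≤ R + 1 →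
      L ν ∈ Metric.closedBall 0 r := by
    obtain ⟨r, hr, hs⟩ := (hK.image hL).isBounded.subset_closedBall_lt 0 0
    exact ⟨r, hr, fun ν hν => hs ⟨ν, hν, rfl⟩⟩
  let ψ : ContDiffBump (0 : Fin (n + 1) → ℝ) := ⟨r, r + 1, hr, by linarith⟩
  let χ : FiniteMeasure E → ℝ := fun ν => Real.smoothTransition (R + 1 - ν.mass)
  let φ : (Fin (n + 1) → ℝ) → ℝ := fun x =>
    ψ x * (Real.smoothTransition (R + 1 - x 0) * MvPolynomial.eval (fun i : Fin n => x i.succ) q)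
  have hφ : ContDiff ℝ (⊤ : ℕ∞) φ := by
    refine ψ.contDiff.mul (ContDiff.mul (Real.smoothTransition.contDiff.comp (by fun_prop)) ?_)
    have hqs : ContDiff ℝ (⊤ : ℕ∞) fun y : Fin n → ℝ => MvPolynomial.eval y q :=
      (AnalyticOnNhd.eval_mvPolynomial q).contDiff
    exact hqs.comp (by fun_prop)
  have hout (ν : FiniteMeasure E) (hν : ¬ ν.mass ≤ R + 1) : φ (L ν) = 0 := by
    have : (R : ℝ) + 1 < ν.mass := by exact_mod_cast not_le.mp hν
    simp only [φ, hL0]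
    rw [Real.smoothTransition.zero_of_nonpos (by linarith)]
    simp
  refine ⟨n + 1, φ, G, hφ, ψ.hasCompactSupport.mul_right, ?_, HasCompactSupport.intro hK hout,
    hφ.continuous.comp hL, fun ν => ?_⟩
  · exact Fin.cases h1 hg
  change |h ν - φ (L ν)| ≤ ε
  by_cases hν : ν.mass ≤ R + 1
  · have hb := hq ν hν
    set p := MvPolynomial.eval (fun i => ∫ x, g i x ∂(ν : Measure E)) q
    have e : φ (L ν) = χ ν * p := by
      simp only [φ, hL0, hLs, χ]
      rw [ψ.one_of_mem_closedBall (hLr ν hν), one_mul]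
    have hc0 : 0 ≤ χ ν := Real.smoothTransition.nonneg _
    have hc1 : χ ν ≤ 1 := Real.smoothTransition.le_one _
    have h3 : (1 - χ ν) * |h ν| ≤ (1 - χ ν) * ε := by
      by_cases hν' : ν ∈ K₀
      · have : (ν.mass : ℝ) ≤ R := by exact_mod_cast hR ν hν'
        have : χ ν = 1 := Real.smoothTransition.one_of_one_le (by linarith)
        simp [this]
      · exact mul_le_mul_of_nonneg_left (hsmall ν hν').le (by linarith)
    calc |h ν - φ (L ν)| = |(1 - χ ν) * h ν - χ ν * (p - h ν)| := by rw [e]; ring_nf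
      _ ≤ |(1 - χ ν) * h ν| + |χ ν * (p - h ν)| := abs_sub _ _
      _ = (1 - χ ν) * |h ν| + χ ν * |p - h ν| := by
        rw [abs_mul, abs_mul, abs_of_nonneg hc0, abs_of_nonneg (sub_nonneg.mpr hc1)]
      _ ≤ (1 - χ ν) * ε + χ ν * ε := add_le_add h3 (mul_le_mul_of_nonneg_left hb.le hc0)
      _ = ε := by ring
  · have : ν ∉ K₀ := fun hν' => hν ((hR ν hν').trans (by simp))
    rw [hout ν hν, sub_zero]
    exact (hsmall ν this).le
end
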